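/- arXiv:2407.19154 — 3 statements merged into one kernel-verified Lean document; each statement's English description precedes it below -/
import Mathlib

section
/- Let K be an invertible 3×3 real matrix. Let r₁, r₂ : Fin 3 → ℝ be unit vectors with r₁ ≠ r₂, and let v₁ = s₁ • r₁ and v₂ = s₂ • r₂ with s₁ > 0 and s₂ > 0. Assume the projected depths d₁ := (K.mulVec v₁) 2 and d₂ := (K.mulVec v₂) 2 are both strictly positive. Then the normalized pixel projections of v₁ and v₂ are distinct: d₁⁻¹ • K.mulVec v₁ ≠ d₂⁻¹ • K.mulVec v₂. (That is, a camera placed at the LiDAR origin produces a depthmap free of projective artifacts: no two scanned points from distinct rays overlap after projection.) -/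
/-- Euclidean norm of a vector in `Fin 3 → ℝ`. -/
noncomputable def euclNorm (v : Fin 3 → ℝ) : ℝ :=
  ‖(EuclideanSpace.equiv (Fin 3) ℝ).symm v‖

lemma euclNorm_smul_of_pos {a : ℝ} (ha : 0 < a) (v : Fin 3 → ℝ) :
    euclNorm (a • v) = a * euclNorm v := by
  simp only [euclNorm, map_smul, norm_smul, Real.norm_of_nonneg ha.le]

/-- Unit vectors spanning the same ray are equal. -/
lemma eq_of_pos_smul_eq_of_euclNorm_eq_one {r₁ r₂ : Fin 3 → ℝ} (hr₁ : euclNorm r₁ = 1)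
    (hr₂ : euclNorm r₂ = 1) {a b : ℝ} (ha : 0 < a) (hb : 0 < b) (h : a • r₁ = b • r₂) :
    r₁ = r₂ := by
  have hab : a = b := by
    simpa [euclNorm_smul_of_pos, ha, hb, hr₁, hr₂] using congrArg euclNorm h
  subst hab
  exact smul_right_injective _ ha.ne' h

/-- A virtual camera placed at the LiDAR origin produces a depthmap free of
projective artifacts: two LiDAR points lying on distinct rays (distinct unit
directions) with positive depths have distinct normalized pixel projections. -/
theorem virtual_lidar_camera_no_artifacts
    (K : Matrix (Fin 3) (Fin 3) ℝ) (hK : IsUnit K)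
    (r₁ r₂ : Fin 3 → ℝ) (hr₁ : euclNorm r₁ = 1) (hr₂ : euclNorm r₂ = 1)
    (hne : r₁ ≠ r₂)
    (s₁ s₂ : ℝ) (hs₁ : 0 < s₁) (hs₂ : 0 < s₂)
    (v₁ v₂ : Fin 3 → ℝ) (hv₁ : v₁ = s₁ • r₁) (hv₂ : v₂ = s₂ • r₂)
    (hd₁ : 0 < (K.mulVec v₁) 2) (hd₂ : 0 < (K.mulVec v₂) 2) :
    ((K.mulVec v₁) 2)⁻¹ • K.mulVec v₁ ≠ ((K.mulVec v₂) 2)⁻¹ • K.mulVec v₂ := by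
  subst hv₁ hv₂
  intro h
  rw [← Matrix.mulVec_smul, ← Matrix.mulVec_smul, smul_smul, smul_smul] at h
  exact hne (eq_of_pos_smul_eq_of_euclNorm_eq_one hr₁ hr₂ (mul_pos (inv_pos.2 hd₁) hs₁)
    (mul_pos (inv_pos.2 hd₂) hs₂) (Matrix.mulVec_injective_of_isUnit hK h))
end

section
/- Consider a pure translation movement with translation τ : Fin 3 → ℝ and z := τ 2. Let p₁, p₂, q : Fin 3 → ℝ be homogeneous pixels with third coordinate 1, and let d₁, d₂ > 0 and d'₁, d'₂ be real numbers with d'ᵢ • q = dᵢ • pᵢ + τ for i = 1, 2 (both left pixels project to the same right pixel q). Then the moving distances satisfy ‖q - pᵢ‖ = ‖τ - z • q‖ / dᵢ, and consequently if d₁ < d₂ then ‖q - p₁‖ ≥ ‖q - p₂‖, with strict inequality whenever τ ≠ z • q. (The pixel closer to the camera moves the longer distance along the epipolar line.) -/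
theorem euclNorm_smul (c : ℝ) (v : Fin 3 → ℝ) : euclNorm (c • v) = |c| * euclNorm v := by
  simp only [euclNorm, map_smul, norm_smul, Real.norm_eq_abs]

theorem euclNorm_nonneg (v : Fin 3 → ℝ) : 0 ≤ euclNorm v :=
  norm_nonneg _

theorem euclNorm_pos {v : Fin 3 → ℝ} (hv : v ≠ 0) : 0 < euclNorm v := by
  simpa [euclNorm] using hv

/-- The displacement of a pixel, scaled by its depth, depends only on `τ` and `q`. -/
theorem depth_smul_displacement {τ p q : Fin 3 → ℝ} (hp : p 2 = 1) (hq : q 2 = 1) {d d' : ℝ}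
    (h : d' • q = d • p + τ) : d • (q - p) = τ - (τ 2) • q := by
  have hz : d' = d + τ 2 := by simpa [hp, hq] using congrFun h 2
  rw [hz, add_smul] at h
  rw [smul_sub, sub_eq_sub_iff_add_eq_add, h, add_comm]

theorem euclNorm_displacement {τ p q : Fin 3 → ℝ} (hp : p 2 = 1) (hq : q 2 = 1) {d d' : ℝ}
    (hd : 0 < d) (h : d' • q = d • p + τ) :
    euclNorm (q - p) = euclNorm (τ - (τ 2) • q) / d := by
  rw [← depth_smul_displacement hp hq h, euclNorm_smul, abs_of_pos hd,
    mul_div_cancel_left₀ _ hd.ne']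

/-- Under a pure translation movement, two left pixels projecting to the same
right pixel `q` have moving distances `‖τ - z • q‖ / dᵢ`; the pixel closer to the
camera moves the longer distance along the epipolar line. -/
theorem closer_pixel_moves_farther
    (τ p₁ p₂ q : Fin 3 → ℝ) (hp₁ : p₁ 2 = 1) (hp₂ : p₂ 2 = 1) (hq : q 2 = 1)
    (d₁ d₂ d'₁ d'₂ : ℝ) (hd₁ : 0 < d₁) (hd₂ : 0 < d₂)
    (h₁ : d'₁ • q = d₁ • p₁ + τ) (h₂ : d'₂ • q = d₂ • p₂ + τ) :
    euclNorm (q - p₁) = euclNorm (τ - (τ 2) • q) / d₁ ∧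
    euclNorm (q - p₂) = euclNorm (τ - (τ 2) • q) / d₂ ∧
    (d₁ < d₂ → euclNorm (q - p₂) ≤ euclNorm (q - p₁)) ∧
    (d₁ < d₂ → τ ≠ (τ 2) • q → euclNorm (q - p₂) < euclNorm (q - p₁)) := by
  have e₁ := euclNorm_displacement hp₁ hq hd₁ h₁
  have e₂ := euclNorm_displacement hp₂ hq hd₂ h₂
  refine ⟨e₁, e₂, fun hlt => ?_, fun hlt hne => ?_⟩
  · rw [e₁, e₂]
    exact div_le_div_of_nonneg_left (euclNorm_nonneg _) hd₁ hlt.le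
  · rw [e₁, e₂]
    exact div_lt_div_of_pos_left (euclNorm_pos (sub_ne_zero.mpr hne)) hd₁ hlt
end

section
/- Consider a pure translation movement with translation τ : Fin 3 → ℝ and z := τ 2. Let p₁, p₂, q : Fin 3 → ℝ be homogeneous pixels with third coordinate 1, let 0 < d₁ < d₂, and suppose d'ᵢ • q = dᵢ • pᵢ + τ for i = 1, 2 (pixel p₁, having larger right-view depth, is occluded by p₂ at q). Assume τ ≠ z • q (so q is not the epipole). Let n := ‖q - p₁‖⁻¹ • (q - p₁) be the unit epipolar direction at p₁. Then ⟪n, p₁ - p₂⟫ < 0: the occluding pixel p₂ resides strictly behind p₁ with respect to the epipolar line direction, i.e. a pixel can only be occluded by pixels lying along the reverse direction of the epipolar line. -/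
open Matrix

/-- Under pure translation, a pixel can only be occluded by pixels lying along
the reverse direction of the epipolar line: if `p₁` (smaller left depth `d₁`) and
`p₂` (larger left depth `d₂`) project to the same right pixel `q` (not the
epipole), then the unit epipolar direction `n` at `p₁` satisfies
`⟪n, p₁ - p₂⟫ < 0`. -/
theorem occluder_lies_behind_along_epipolar_line
    (τ p₁ p₂ q : Fin 3 → ℝ) (hp₁ : p₁ 2 = 1) (hp₂ : p₂ 2 = 1) (hq : q 2 = 1)
    (d₁ d₂ d'₁ d'₂ : ℝ) (hd₁ : 0 < d₁) (hlt : d₁ < d₂)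
    (h₁ : d'₁ • q = d₁ • p₁ + τ) (h₂ : d'₂ • q = d₂ • p₂ + τ)
    (hepi : τ ≠ (τ 2) • q) :
    ((euclNorm (q - p₁))⁻¹ • (q - p₁)) ⬝ᵥ (p₁ - p₂) < 0 := by
  have hz₁ : d'₁ = d₁ + τ 2 := by simpa [hp₁, hq] using congrFun h₁ 2
  have hz₂ : d'₂ = d₂ + τ 2 := by simpa [hp₂, hq] using congrFun h₂ 2
  have hd₂ : 0 < d₂ := hd₁.trans hlt
  have hw₁ : d₁ • (q - p₁) = τ - τ 2 • q := by
    rw [hz₁, add_smul] at h₁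
    rw [smul_sub, sub_eq_sub_iff_add_eq_add, h₁, add_comm]
  have hw₂ : d₂ • (q - p₂) = τ - τ 2 • q := by
    rw [hz₂, add_smul] at h₂
    rw [smul_sub, sub_eq_sub_iff_add_eq_add, h₂, add_comm]
  have hne : q - p₁ ≠ 0 := by
    intro h
    rw [h, smul_zero] at hw₁
    exact hepi (sub_eq_zero.mp hw₁.symm)
  have hq₂ : q - p₂ = (d₁ / d₂) • (q - p₁) := by
    rw [div_eq_inv_mul, mul_smul, hw₁, ← hw₂, inv_smul_smul₀ hd₂.ne']
  have hdiff : p₁ - p₂ = (d₁ / d₂ - 1) • (q - p₁) := by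
    rw [sub_smul, one_smul, ← hq₂, sub_sub_sub_cancel_left]
  have hnorm : 0 < euclNorm (q - p₁) :=
    norm_pos_iff.mpr ((EuclideanSpace.equiv (Fin 3) ℝ).symm.map_ne_zero_iff.mpr hne)
  have hdot : 0 < (q - p₁) ⬝ᵥ (q - p₁) :=
    lt_of_le_of_ne (Finset.sum_nonneg fun i _ => mul_self_nonneg _)
      fun h => hne (dotProduct_self_eq_zero.mp h.symm)
  rw [hdiff, smul_dotProduct, dotProduct_smul, smul_eq_mul, smul_eq_mul]
  exact mul_neg_of_pos_of_neg (inv_pos.mpr hnorm)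
    (mul_neg_of_neg_of_pos (sub_neg.mpr ((div_lt_one hd₂).mpr hlt)) hdot)
end
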